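/- With the canonical bracket {x_i, y_i} = 1/2 and the variables a_k = g_k^{-2}, b_k = u_k/(g_{k-1} g_k) - λ, one has {b_k, a_k} = -a_k(b_k² + a_k) - 2 b_k a_k λ - a_k λ². -/

import Mathlib

noncomputable section

open Function

/-- The canonical Poisson bracket on `ℝ^{2N}` with coordinates
`(x_i, y_i)`, `i : ZMod N`, determined by `{x_i, y_i} = 1/2` and all other
coordinate brackets zero:
`{f, g} = (1/2) ∑ i (∂f/∂x_i ∂g/∂y_i - ∂f/∂y_i ∂g/∂x_i)`. -/
def pb (N : ℕ) [NeZero N] (f g : (ZMod N → ℝ) × (ZMod N → ℝ) → ℝ)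
    (p : (ZMod N → ℝ) × (ZMod N → ℝ)) : ℝ :=
  (1 / 2) * ∑ i : ZMod N,
    (deriv (fun t => f (Function.update p.1 i t, p.2)) (p.1 i) *
        deriv (fun t => g (p.1, Function.update p.2 i t)) (p.2 i) -
      deriv (fun t => f (p.1, Function.update p.2 i t)) (p.2 i) *
        deriv (fun t => g (Function.update p.1 i t, p.2)) (p.1 i))

/-- `g_k = x_k y_{k+1} - y_k x_{k+1}` (indices mod `N`). -/
def Gv (N : ℕ) (k : ZMod N) (p : (ZMod N → ℝ) × (ZMod N → ℝ)) : ℝ :=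
  p.1 k * p.2 (k + 1) - p.2 k * p.1 (k + 1)

/-- `u_k = x_{k-1} y_{k+1} - y_{k-1} x_{k+1}` (indices mod `N`). -/
def Uv (N : ℕ) (k : ZMod N) (p : (ZMod N → ℝ) × (ZMod N → ℝ)) : ℝ :=
  p.1 (k - 1) * p.2 (k + 1) - p.2 (k - 1) * p.1 (k + 1)

/-- Flaschka–Manakov variable `a_k = g_k^{-2}`. -/
def Av (N : ℕ) (k : ZMod N) (p : (ZMod N → ℝ) × (ZMod N → ℝ)) : ℝ :=
  (Gv N k p ^ 2)⁻¹

/-- Flaschka–Manakov variable `b_k = u_k/(g_{k-1} g_k) - λ`. -/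
def Bv (N : ℕ) (lam : ℝ) (k : ZMod N) (p : (ZMod N → ℝ) × (ZMod N → ℝ)) : ℝ :=
  Uv N k p / (Gv N (k - 1) p * Gv N k p) - lam

theorem hasDerivAt_update_apply {ι : Type*} [Fintype ι] [DecidableEq ι] (x : ι → ℝ) (i j : ι)
    (t : ℝ) :
    HasDerivAt (fun s => Function.update x i s j) (Pi.single (M := fun _ => ℝ) i 1 j) t :=
  hasDerivAt_pi.1 (hasDerivAt_update x i t) j

theorem hasDerivAt_Av {N : ℕ} {k : ZMod N} {c : ℝ → (ZMod N → ℝ) × (ZMod N → ℝ)} {t g' : ℝ}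
    (hG : HasDerivAt (fun s => Gv N k (c s)) g' t) (hg : Gv N k (c t) ≠ 0) :
    HasDerivAt (fun s => Av N k (c s)) (-2 * g' / Gv N k (c t) ^ 3) t := by
  refine ((hG.fun_pow 2).fun_inv (pow_ne_zero 2 hg)).congr_deriv ?_
  field_simp
  norm_num
  ring

theorem hasDerivAt_Bv {N : ℕ} (lam : ℝ) {k : ZMod N} {c : ℝ → (ZMod N → ℝ) × (ZMod N → ℝ)}
    {t u' f' g' : ℝ} (hU : HasDerivAt (fun s => Uv N k (c s)) u' t)
    (hF : HasDerivAt (fun s => Gv N (k - 1) (c s)) f' t)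
    (hG : HasDerivAt (fun s => Gv N k (c s)) g' t)
    (hf : Gv N (k - 1) (c t) ≠ 0) (hg : Gv N k (c t) ≠ 0) :
    HasDerivAt (fun s => Bv N lam k (c s))
      ((u' * (Gv N (k - 1) (c t) * Gv N k (c t)) -
        Uv N k (c t) * (f' * Gv N k (c t) + Gv N (k - 1) (c t) * g')) /
          (Gv N (k - 1) (c t) * Gv N k (c t)) ^ 2) t :=
  (hU.fun_div (hF.fun_mul hG) (mul_ne_zero hf hg)).sub_const lam

/-- The determinant `x_i y_j - y_i x_j` of two points; both `Gv` and `Uv` are of this form. -/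
def crossAt (N : ℕ) (i j : ZMod N) (p : (ZMod N → ℝ) × (ZMod N → ℝ)) : ℝ :=
  p.1 i * p.2 j - p.2 i * p.1 j

theorem hasDerivAt_crossAt_fst (N : ℕ) [NeZero N] (i j l : ZMod N)
    (p : (ZMod N → ℝ) × (ZMod N → ℝ)) (t : ℝ) :
    HasDerivAt (fun s => crossAt N i j (Function.update p.1 l s, p.2))
      (Pi.single (M := fun _ => ℝ) l 1 i * p.2 j -
        p.2 i * Pi.single (M := fun _ => ℝ) l 1 j) t :=
  ((hasDerivAt_update_apply p.1 l i t).mul_const _).fun_sub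
    ((hasDerivAt_update_apply p.1 l j t).const_mul _)

theorem hasDerivAt_crossAt_snd (N : ℕ) [NeZero N] (i j l : ZMod N)
    (p : (ZMod N → ℝ) × (ZMod N → ℝ)) (t : ℝ) :
    HasDerivAt (fun s => crossAt N i j (p.1, Function.update p.2 l s))
      (p.1 i * Pi.single (M := fun _ => ℝ) l 1 j -
        Pi.single (M := fun _ => ℝ) l 1 i * p.1 j) t :=
  ((hasDerivAt_update_apply p.2 l j t).const_mul _).fun_sub
    ((hasDerivAt_update_apply p.2 l i t).mul_const _)

theorem stmt10 (N : ℕ) [NeZero N] (hN : 3 < N) (lam : ℝ)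
    (p : (ZMod N → ℝ) × (ZMod N → ℝ)) (hg : ∀ k, Gv N k p ≠ 0) (k : ZMod N) :
    pb N (Bv N lam k) (Av N k) p =
      -(Av N k p) * (Bv N lam k p ^ 2 + Av N k p)
        - 2 * Bv N lam k p * Av N k p * lam - Av N k p * lam ^ 2 := by
  have : Fact (1 < N) := ⟨by omega⟩
  have two_ne : (2 : ZMod N) ≠ 0 := fun h => by
    have h' : ((2 : ℕ) : ZMod N) = 0 := by exact_mod_cast h
    exact absurd (Nat.le_of_dvd two_pos ((ZMod.natCast_eq_zero_iff 2 N).1 h')) (by omega)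
  have hk : k ≠ k + 1 := by simp
  have hk₁ : k - 1 ≠ k := by simp
  have hk₂ : k - 1 ≠ k + 1 := fun h => two_ne (by linear_combination -h)
  have hx (i : ZMod N) : (Function.update p.1 i (p.1 i), p.2) = p := by simp
  have hy (i : ZMod N) : (p.1, Function.update p.2 i (p.2 i)) = p := by simp
  have hAx (i : ZMod N) := (hasDerivAt_Av (hasDerivAt_crossAt_fst N k (k + 1) i p (p.1 i))
    (by rw [hx]; exact hg k)).deriv
  have hAy (i : ZMod N) := (hasDerivAt_Av (hasDerivAt_crossAt_snd N k (k + 1) i p (p.2 i))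
    (by rw [hy]; exact hg k)).deriv
  have hBx (i : ZMod N) := (hasDerivAt_Bv lam
    (hasDerivAt_crossAt_fst N (k - 1) (k + 1) i p (p.1 i))
    (hasDerivAt_crossAt_fst N (k - 1) (k - 1 + 1) i p (p.1 i))
    (hasDerivAt_crossAt_fst N k (k + 1) i p (p.1 i))
    (by rw [hx]; exact hg (k - 1)) (by rw [hx]; exact hg k)).deriv
  have hBy (i : ZMod N) := (hasDerivAt_Bv lam
    (hasDerivAt_crossAt_snd N (k - 1) (k + 1) i p (p.2 i))
    (hasDerivAt_crossAt_snd N (k - 1) (k - 1 + 1) i p (p.2 i))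
    (hasDerivAt_crossAt_snd N k (k + 1) i p (p.2 i))
    (by rw [hy]; exact hg (k - 1)) (by rw [hy]; exact hg k)).deriv
  simp only [hx, hy, sub_add_cancel] at hAx hAy hBx hBy
  simp only [pb, hAx, hAy, hBx, hBy]
  rw [← Finset.sum_subset (Finset.subset_univ {k, k + 1}), Finset.sum_pair hk]
  · have hf := hg (k - 1)
    have hg' := hg k
    simp only [Pi.single_apply, hk, hk.symm, hk₁, hk₂, if_true, if_false, Av, Bv]
    have eF : Gv N (k - 1) p = p.1 (k - 1) * p.2 k - p.2 (k - 1) * p.1 k := by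
      simp [Gv]
    have eU : Uv N k p = p.1 (k - 1) * p.2 (k + 1) - p.2 (k - 1) * p.1 (k + 1) := rfl
    have eG : Gv N k p = p.1 k * p.2 (k + 1) - p.2 k * p.1 (k + 1) := rfl
    generalize Gv N (k - 1) p = F at *
    generalize Gv N k p = G at *
    generalize Uv N k p = U at *
    field_simp
    subst eF eU eG
    ring
  · intro i _ hi
    simp only [Finset.mem_insert, Finset.mem_singleton, not_or] at hi
    simp [Pi.single_apply, Ne.symm hi.1, Ne.symm hi.2]
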